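/- For every k, M ∈ ℕ and ε ∈ [0, 1/2), there exists ℓ = ℓ(k, M, ε) ∈ ℕ (one may take ℓ ≤ tower of 2s of height O(Mk/(1−2ε))) such that: if A ⊆ F_2^n satisfies ‖1_A‖_{A,ε} ≤ M and both A and A^c are k-affine connected, then A has coset complexity at most ℓ; in particular ‖1_A‖_A ≤ 3^ℓ. -/

import Mathlib

open Finset
open scoped Classical

noncomputable def chi {n : ℕ} (a x : Fin n → ZMod 2) : ℝ :=
  if ∑ i, a i * x i = (0 : ZMod 2) then 1 else -1

noncomputable def fhat {n : ℕ} (f : (Fin n → ZMod 2) → ℝ) (a : Fin n → ZMod 2) : ℝ :=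
  (∑ x, f x * chi a x) / 2 ^ n

noncomputable def specNorm {n : ℕ} (f : (Fin n → ZMod 2) → ℝ) : ℝ :=
  ∑ a, |fhat f a|

/-- The `ε`-approximate spectral norm `‖f‖_{A,ε} = inf {‖g‖_A : ‖f − g‖_∞ ≤ ε}`. -/
noncomputable def approxSpecNorm {n : ℕ} (f : (Fin n → ZMod 2) → ℝ) (ε : ℝ) : ℝ :=
  sInf (specNorm '' {g | ∀ x, |f x - g x| ≤ ε})

noncomputable def ind {n : ℕ} (A : Set (Fin n → ZMod 2)) : (Fin n → ZMod 2) → ℝ :=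
  fun x => if x ∈ A then 1 else 0

def IsCoset {n : ℕ} (C : Set (Fin n → ZMod 2)) : Prop :=
  ∃ (W : Submodule (ZMod 2) (Fin n → ZMod 2)) (c : Fin n → ZMod 2),
    C = {x | x - c ∈ W}

inductive InSetRing {α : Type*} (S : Set (Set α)) : Set α → Prop
  | base {A : Set α} : A ∈ S → InSetRing S A
  | univ : InSetRing S Set.univ
  | compl {A : Set α} : InSetRing S A → InSetRing S Aᶜ
  | union {A B : Set α} : InSetRing S A → InSetRing S B → InSetRing S (A ∪ B)
  | inter {A B : Set α} : InSetRing S A → InSetRing S B → InSetRing S (A ∩ B)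

def CosetCplxLe {n : ℕ} (A : Set (Fin n → ZMod 2)) (ℓ : ℕ) : Prop :=
  ∃ (t : ℕ) (C : Fin t → Set (Fin n → ZMod 2)),
    t ≤ ℓ ∧ (∀ i, IsCoset (C i)) ∧ InSetRing (Set.range C) A

def KAffineConnected {n : ℕ} (k : ℕ) (A : Set (Fin n → ZMod 2)) : Prop :=
  ∀ (a₀ : Fin n → ZMod 2) (a : Fin k → Fin n → ZMod 2),
    a₀ ∈ A → (∀ i, a₀ + a i ∈ A) →
    (¬ AffineIndependent (ZMod 2) (Fin.cons a₀ (fun i => a₀ + a i))) ∨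
    ∃ T : Finset (Fin k), 2 ≤ T.card ∧ a₀ + ∑ i ∈ T, a i ∈ A

lemma chi_comm {n : ℕ} (a x : Fin n → ZMod 2) : chi a x = chi x a := by
  simp only [chi, mul_comm]

lemma chi_add_right {n : ℕ} (a x y : Fin n → ZMod 2) :
    chi a (x + y) = chi a x * chi a y := by
  have key : ∀ s t : ZMod 2, (if s + t = 0 then (1 : ℝ) else -1)
      = (if s = 0 then 1 else -1) * (if t = 0 then 1 else -1) := by
    have h2 : ∀ s : ZMod 2, s = 0 ∨ s = 1 := by decide
    have h11 : (1 : ZMod 2) + 1 = 0 := by decide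
    intro s t
    rcases h2 s with rfl | rfl <;> rcases h2 t with rfl | rfl <;> simp [h11]
  simp only [chi, Pi.add_apply, mul_add, Finset.sum_add_distrib]
  exact key _ _

lemma chi_add_left {n : ℕ} (a b x : Fin n → ZMod 2) :
    chi (a + b) x = chi a x * chi b x := by
  rw [chi_comm, chi_add_right, chi_comm x a, chi_comm x b]

@[simp] lemma chi_zero_right {n : ℕ} (a : Fin n → ZMod 2) : chi a 0 = 1 := by simp [chi]

@[simp] lemma chi_zero_left {n : ℕ} (x : Fin n → ZMod 2) : chi 0 x = 1 := by simp [chi]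

lemma abs_chi {n : ℕ} (a x : Fin n → ZMod 2) : |chi a x| = 1 := by
  unfold chi; split_ifs <;> simp

lemma chi_mul_self {n : ℕ} (a x : Fin n → ZMod 2) : chi a x * chi a x = 1 := by
  unfold chi; split_ifs <;> simp

lemma chi_sum {n : ℕ} {ι : Type*} (a : Fin n → ZMod 2) (s : Finset ι)
    (x : ι → Fin n → ZMod 2) : chi a (∑ j ∈ s, x j) = ∏ j ∈ s, chi a (x j) := by
  induction s using Finset.induction_on with
  | empty => simp
  | insert j s hj ih => rw [Finset.sum_insert hj, Finset.prod_insert hj, chi_add_right, ih]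

lemma sum_chi_left {n : ℕ} (z : Fin n → ZMod 2) :
    ∑ a, chi a z = if z = 0 then (2 : ℝ) ^ n else 0 := by
  split_ifs with hz
  · subst hz
    simp
  · obtain ⟨i, hi⟩ : ∃ i, z i ≠ 0 := by
      by_contra! h
      exact hz (funext h)
    obtain ⟨e, he⟩ : ∃ e : Fin n → ZMod 2, chi e z = -1 :=
      ⟨Pi.single i 1, by simp [chi, Pi.single_apply, hi]⟩
    have : ∑ a, chi a z = ∑ a, chi (e + a) z :=
      (Equiv.sum_comp (Equiv.addLeft e) fun a => chi a z).symm
    simp only [chi_add_left, he, neg_mul, one_mul, Finset.sum_neg_distrib] at this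
    linarith

lemma fourier_inversion {n : ℕ} (g : (Fin n → ZMod 2) → ℝ) (x : Fin n → ZMod 2) :
    g x = ∑ a, fhat g a * chi a x := by
  have h1 : ∀ a, fhat g a * chi a x = (∑ y, g y * chi a (y + x)) / 2 ^ n := by
    intro a
    simp only [fhat, chi_add_right, div_mul_eq_mul_div, Finset.sum_mul, mul_assoc]
  simp only [h1]
  rw [← Finset.sum_div, Finset.sum_comm]
  simp only [← Finset.mul_sum, sum_chi_left]
  have h2 : ∀ y, y + x = 0 ↔ y = x := fun y => by
    rw [add_eq_zero_iff_eq_neg, ZModModule.neg_eq_self]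
  simp [h2]

lemma fhat_of_rep {n : ℕ} {g c : (Fin n → ZMod 2) → ℝ}
    (h : ∀ x, g x = ∑ a, c a * chi a x) (b : Fin n → ZMod 2) : fhat g b = c b := by
  have h1 : ∀ x, g x * chi b x = ∑ a, c a * chi x (a + b) := by
    intro x
    rw [h, Finset.sum_mul]
    refine Finset.sum_congr rfl fun a _ => ?_
    rw [chi_comm x, chi_add_left, mul_assoc]
  simp only [fhat, h1]
  rw [Finset.sum_comm]
  simp only [← Finset.mul_sum, sum_chi_left]
  have h2 : ∀ y, y + b = 0 ↔ y = b := fun y => by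
    rw [add_eq_zero_iff_eq_neg, ZModModule.neg_eq_self]
  simp [h2]

lemma specNorm_of_rep {n : ℕ} {g c : (Fin n → ZMod 2) → ℝ}
    (h : ∀ x, g x = ∑ a, c a * chi a x) : specNorm g = ∑ a, |c a| := by
  simp only [specNorm, fhat_of_rep h]

lemma specNorm_nonneg {n : ℕ} (g : (Fin n → ZMod 2) → ℝ) : 0 ≤ specNorm g :=
  Finset.sum_nonneg fun _ _ => abs_nonneg _

lemma specNorm_sum_le {n : ℕ} {ι : Type*} (s : Finset ι) (f : ι → (Fin n → ZMod 2) → ℝ) :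
    specNorm (fun x => ∑ j ∈ s, f j x) ≤ ∑ j ∈ s, specNorm (f j) := by
  have h : ∀ x, ∑ j ∈ s, f j x = ∑ a, (∑ j ∈ s, fhat (f j) a) * chi a x := by
    intro x
    simp only [Finset.sum_mul]
    rw [Finset.sum_comm]
    exact Finset.sum_congr rfl fun j _ => fourier_inversion (f j) x
  rw [specNorm_of_rep h]
  simp only [specNorm]
  rw [Finset.sum_comm]
  exact Finset.sum_le_sum fun a _ => Finset.abs_sum_le_sum_abs _ _

lemma specNorm_mul_le {n : ℕ} (f g : (Fin n → ZMod 2) → ℝ) :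
    specNorm (fun x => f x * g x) ≤ specNorm f * specNorm g := by
  have h : ∀ x, f x * g x = ∑ a, (∑ b, fhat f b * fhat g (a + b)) * chi a x := by
    intro x
    rw [fourier_inversion f x, fourier_inversion g x, Finset.sum_mul_sum]
    simp only [Finset.sum_mul]
    rw [Finset.sum_comm (s := univ) (t := univ)
      (f := fun a b => fhat f b * fhat g (a + b) * chi a x)]
    refine Finset.sum_congr rfl fun b _ => ?_
    rw [← Equiv.sum_comp (Equiv.addRight b)]
    refine Finset.sum_congr rfl fun a _ => ?_
    simp only [Equiv.coe_addRight, chi_add_left]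
    linear_combination (fhat f b * fhat g (a + b) * chi a x) * chi_mul_self b x
  rw [specNorm_of_rep h]
  calc ∑ a, |∑ b, fhat f b * fhat g (a + b)|
      ≤ ∑ a, ∑ b, |fhat f b| * |fhat g (a + b)| :=
        Finset.sum_le_sum fun a _ => (Finset.abs_sum_le_sum_abs _ _).trans_eq
          (Finset.sum_congr rfl fun b _ => abs_mul _ _)
    _ = specNorm f * specNorm g := by
        rw [Finset.sum_comm]
        simp only [specNorm, Finset.sum_mul]
        refine Finset.sum_congr rfl fun b _ => ?_
        rw [← Finset.mul_sum]
        congr 1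
        exact Equiv.sum_comp (Equiv.addRight b) fun a => |fhat g a|

lemma specNorm_const {n : ℕ} (r : ℝ) : specNorm (fun _ : Fin n → ZMod 2 => r) = |r| := by
  have h : ∀ x : Fin n → ZMod 2, r = ∑ a, (if a = 0 then r else 0) * chi a x := by
    intro x
    simp
  rw [specNorm_of_rep (g := fun _ => r) h, Finset.sum_eq_single 0]
  · simp
  · intro b _ hb
    simp [hb]
  · simp

lemma specNorm_prod_le {n : ℕ} {ι : Type*} (s : Finset ι) (f : ι → (Fin n → ZMod 2) → ℝ) :
    specNorm (fun x => ∏ j ∈ s, f j x) ≤ ∏ j ∈ s, specNorm (f j) := by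
  induction s using Finset.induction_on with
  | empty => simp [specNorm_const]
  | insert j s hj ih =>
    simp only [Finset.prod_insert hj]
    exact (specNorm_mul_le _ _).trans (mul_le_mul_of_nonneg_left ih (specNorm_nonneg _))

lemma specNorm_sub_le {n : ℕ} (f g : (Fin n → ZMod 2) → ℝ) :
    specNorm (fun x => f x - g x) ≤ specNorm f + specNorm g := by
  have h : ∀ x, f x - g x = ∑ a, (fhat f a - fhat g a) * chi a x := by
    intro x
    simp only [sub_mul, Finset.sum_sub_distrib, ← fourier_inversion]
  rw [specNorm_of_rep h, specNorm, specNorm, ← Finset.sum_add_distrib]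
  exact Finset.sum_le_sum fun a _ => abs_sub _ _

lemma specNorm_ind_coset {n : ℕ} {C : Set (Fin n → ZMod 2)} (hC : IsCoset C) :
    specNorm (ind C) ≤ 1 := by
  obtain ⟨W, c, rfl⟩ := hC
  have hnn : ∀ a, 0 ≤ ∑ w, ind (W : Set (Fin n → ZMod 2)) w * chi a w := by
    intro a
    by_cases h : ∀ w ∈ W, chi a w = 1
    · refine Finset.sum_nonneg fun w _ => ?_
      by_cases hw : w ∈ W
      · simp [ind, hw, h w hw]
      · simp [ind, hw]
    · push Not at h
      obtain ⟨w₀, hw₀, hne⟩ := h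
      have hm : chi a w₀ = -1 := by
        unfold chi at hne ⊢
        split_ifs at hne ⊢ <;> simp_all
      have : ∑ w, ind (W : Set (Fin n → ZMod 2)) w * chi a w
          = ∑ w, ind (W : Set (Fin n → ZMod 2)) (w₀ + w) * chi a (w₀ + w) :=
        (Equiv.sum_comp (Equiv.addLeft w₀) fun w => ind (W : Set _) w * chi a w).symm
      have h2 : ∀ w, ind (W : Set (Fin n → ZMod 2)) (w₀ + w) * chi a (w₀ + w)
          = -(ind (W : Set (Fin n → ZMod 2)) w * chi a w) := by
        intro w
        simp only [ind, SetLike.mem_coe, W.add_mem_iff_right hw₀, chi_add_right, hm]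
        ring
      simp only [h2, Finset.sum_neg_distrib] at this
      linarith
  have hf : ∀ a, |fhat (ind {x | x - c ∈ W}) a|
      = (∑ w, ind (W : Set (Fin n → ZMod 2)) w * chi a w) / 2 ^ n := by
    intro a
    have : ∑ x, ind {x | x - c ∈ W} x * chi a x
        = (∑ w, ind (W : Set (Fin n → ZMod 2)) w * chi a w) * chi a c := by
      rw [← Equiv.sum_comp (Equiv.addRight c), Finset.sum_mul]
      refine Finset.sum_congr rfl fun w _ => ?_
      simp [ind, chi_add_right]
    rw [fhat, this, abs_div, abs_mul, abs_chi, abs_of_nonneg (hnn a), mul_one,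
      abs_of_nonneg (by positivity : (0 : ℝ) ≤ 2 ^ n)]
  simp only [specNorm, hf]
  rw [← Finset.sum_div, Finset.sum_comm]
  simp only [← Finset.mul_sum, sum_chi_left]
  simp [ind]

lemma InSetRing.exists_pattern {α : Type*} {t : ℕ} {C : Fin t → Set α} {A : Set α}
    (h : InSetRing (Set.range C) A) :
    ∃ P : Set (Fin t → Bool), ∀ x, x ∈ A ↔ (fun i => decide (x ∈ C i)) ∈ P := by
  induction h with
  | base h =>
    obtain ⟨i, rfl⟩ := h
    exact ⟨{σ | σ i = true}, fun x => by simp⟩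
  | univ => exact ⟨Set.univ, fun x => by simp⟩
  | compl _ ih =>
    obtain ⟨P, hP⟩ := ih
    exact ⟨Pᶜ, fun x => by simp [hP]⟩
  | union _ _ ih₁ ih₂ =>
    obtain ⟨P, hP⟩ := ih₁
    obtain ⟨Q, hQ⟩ := ih₂
    exact ⟨P ∪ Q, fun x => by simp [hP, hQ]⟩
  | inter _ _ ih₁ ih₂ =>
    obtain ⟨P, hP⟩ := ih₁
    obtain ⟨Q, hQ⟩ := ih₂
    exact ⟨P ∩ Q, fun x => by simp [hP, hQ]⟩

lemma CosetCplxLe.specNorm_le {n ℓ : ℕ} {A : Set (Fin n → ZMod 2)} (h : CosetCplxLe A ℓ) :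
    specNorm (ind A) ≤ 3 ^ ℓ := by
  obtain ⟨t, C, ht, hC, hA⟩ := h
  obtain ⟨P, hP⟩ := hA.exists_pattern
  set F : Fin t → Bool → (Fin n → ZMod 2) → ℝ :=
    fun i b x => if b then ind (C i) x else 1 - ind (C i) x with hF
  have hFval : ∀ i b x, F i b x = if decide (x ∈ C i) = b then 1 else 0 := by
    intro i b x
    by_cases hx : x ∈ C i <;> cases b <;> simp [hF, ind, hx]
  have hrep : ind A = fun x => ∑ σ ∈ univ.filter (· ∈ P), ∏ i, F i (σ i) x := by
    funext x
    have hprod : ∀ σ : Fin t → Bool,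
        ∏ i, F i (σ i) x = if (fun i => decide (x ∈ C i)) = σ then 1 else 0 := by
      intro σ
      simp only [hFval, Finset.prod_ite_zero, Finset.prod_const_one, funext_iff]
      simp
    simp only [hprod, Finset.sum_ite_eq]
    simp [ind, hP]
  have hnorm : ∀ i b, specNorm (F i b) ≤ if b then 1 else 2 := by
    intro i b
    cases b
    · have := specNorm_sub_le (fun _ => 1) (ind (C i))
      rw [specNorm_const] at this
      have h1 := specNorm_ind_coset (hC i)
      simp only [hF, Bool.false_eq_true, if_false]
      norm_num at this ⊢
      linarith
    · simpa [hF] using specNorm_ind_coset (hC i)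
  rw [hrep]
  calc specNorm (fun x => ∑ σ ∈ univ.filter (· ∈ P), ∏ i, F i (σ i) x)
      ≤ ∑ σ ∈ univ.filter (· ∈ P), ∏ i, specNorm (F i (σ i)) :=
        (specNorm_sum_le _ _).trans (Finset.sum_le_sum fun σ _ => specNorm_prod_le _ _)
    _ ≤ ∑ σ : Fin t → Bool, ∏ i, specNorm (F i (σ i)) :=
        Finset.sum_le_sum_of_subset_of_nonneg (Finset.subset_univ _)
          fun σ _ _ => Finset.prod_nonneg fun i _ => specNorm_nonneg _
    _ = ∏ i, ∑ b, specNorm (F i b) := by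
        rw [Finset.prod_univ_sum, Fintype.piFinset_univ]
    _ ≤ ∏ _i : Fin t, (3 : ℝ) := by
        refine Finset.prod_le_prod (fun i _ => Finset.sum_nonneg fun b _ => specNorm_nonneg _)
          fun i _ => ?_
        have h1 := hnorm i true
        have h2 := hnorm i false
        simp only [Fintype.sum_bool]
        norm_num at h1 h2
        linarith
    _ = 3 ^ t := by simp
    _ ≤ 3 ^ ℓ := pow_le_pow_right₀ (by norm_num) ht

lemma exists_approximant {n : ℕ} {f : (Fin n → ZMod 2) → ℝ} {ε M : ℝ} (hε : 0 ≤ ε)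
    (h : approxSpecNorm f ε ≤ M) :
    ∃ c : (Fin n → ZMod 2) → ℝ, ∑ a, |c a| ≤ M + 1 ∧
      ∀ x, |f x - ∑ a, c a * chi a x| ≤ ε := by
  have hne : (specNorm '' {g | ∀ x, |f x - g x| ≤ ε}).Nonempty :=
    ⟨_, f, fun x => by simpa using hε, rfl⟩
  obtain ⟨_, ⟨g, hg, rfl⟩, hlt⟩ := exists_lt_of_csInf_lt hne (lt_of_le_of_lt h (lt_add_one M))
  exact ⟨fhat g, hlt.le, fun x => by rw [← fourier_inversion]; exact hg x⟩

/-- There is a complete binary decision tree of depth `d` whose queries have the form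
`x + v ∈ A` and all of whose leaves are reached by points of `X`. -/
def HasSplitTree {G : Type*} [Add G] (A : Set G) : ℕ → Set G → Prop
  | 0, X => X.Nonempty
  | d + 1, X => ∃ v, HasSplitTree A d {x | x ∈ X ∧ x + v ∈ A} ∧
      HasSplitTree A d {x | x ∈ X ∧ x + v ∉ A}

lemma HasSplitTree.mono {G : Type*} [Add G] {A : Set G} {d : ℕ} {X Y : Set G}
    (h : HasSplitTree A d X) (hXY : X ⊆ Y) : HasSplitTree A d Y := by
  induction d generalizing X Y with
  | zero => exact Set.Nonempty.mono hXY h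
  | succ d ih =>
    obtain ⟨v, h₁, h₂⟩ := h
    exact ⟨v, ih h₁ fun x hx => ⟨hXY hx.1, hx.2⟩, ih h₂ fun x hx => ⟨hXY hx.1, hx.2⟩⟩

lemma exists_weight_of_hasSplitTree {n : ℕ} {A : Set (Fin n → ZMod 2)}
    {c : (Fin n → ZMod 2) → ℝ} {γ : ℝ} (hA : ∀ x ∈ A, γ ≤ ∑ a, c a * chi a x)
    (hA' : ∀ x ∉ A, ∑ a, c a * chi a x ≤ -γ) (d : ℕ) (X : Set (Fin n → ZMod 2))
    (w : (Fin n → ZMod 2) → ℝ) (h : HasSplitTree A d X) :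
    ∃ x ∈ X, ∃ w' : (Fin n → ZMod 2) → ℝ,
      ∑ a, |c a| * w' a ^ 2 ≤ ∑ a, |c a| * w a ^ 2 + d * ∑ a, |c a| ∧
      ∑ a, c a * chi a x * w a + d * γ ≤ ∑ a, c a * chi a x * w' a := by
  induction d generalizing X w with
  | zero =>
    obtain ⟨x, hx⟩ := h
    exact ⟨x, hx, w, by simp, by simp⟩
  | succ d ih =>
    obtain ⟨v, h₁, h₂⟩ := h
    have henergy : ∀ s : ℝ, s * s = 1 → ∑ a, |c a| * (w a + s * chi a v) ^ 2
        = ∑ a, |c a| * w a ^ 2 + 2 * s * ∑ a, |c a| * w a * chi a v + ∑ a, |c a| := by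
      intro s hs
      rw [Finset.mul_sum, ← Finset.sum_add_distrib, ← Finset.sum_add_distrib]
      refine Finset.sum_congr rfl fun a _ => ?_
      linear_combination |c a| * hs + |c a| * s * s * chi_mul_self a v
    have hcorr : ∀ (s : ℝ) x, ∑ a, c a * chi a x * (w a + s * chi a v)
        = ∑ a, c a * chi a x * w a + s * ∑ a, c a * chi a (x + v) := by
      intro s x
      rw [Finset.mul_sum, ← Finset.sum_add_distrib]
      refine Finset.sum_congr rfl fun a _ => ?_
      rw [chi_add_right]
      ring
    rcases le_total (∑ a, |c a| * w a * chi a v) 0 with hs | hs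
    · obtain ⟨x, hx, w', he, hw⟩ := ih _ (fun a => w a + 1 * chi a v) h₁
      refine ⟨x, hx.1, w', ?_, ?_⟩
      · rw [henergy 1 (by norm_num)] at he
        push_cast
        linarith
      · rw [hcorr] at hw
        have := hA _ hx.2
        push_cast
        linarith
    · obtain ⟨x, hx, w', he, hw⟩ := ih _ (fun a => w a + (-1) * chi a v) h₂
      refine ⟨x, hx.1, w', ?_, ?_⟩
      · rw [henergy (-1) (by norm_num)] at he
        push_cast
        linarith
      · rw [hcorr] at hw
        have := hA' _ hx.2
        push_cast
        linarith

/-- The perceptron bound: the depth of a split tree is controlled by the spectral norm of a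
function separating the set from its complement with margin `γ`. -/
lemma splitTree_depth_le {n : ℕ} {A : Set (Fin n → ZMod 2)}
    {c : (Fin n → ZMod 2) → ℝ} {γ : ℝ} (hγ : 0 ≤ γ) (hA : ∀ x ∈ A, γ ≤ ∑ a, c a * chi a x)
    (hA' : ∀ x ∉ A, ∑ a, c a * chi a x ≤ -γ) {d : ℕ} {X : Set (Fin n → ZMod 2)}
    (h : HasSplitTree A d X) : d * γ ^ 2 ≤ (∑ a, |c a|) ^ 2 := by
  obtain ⟨x, -, w, he, hw⟩ := exists_weight_of_hasSplitTree hA hA' d X 0 h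
  have hcs : (∑ a, c a * chi a x * w a) ^ 2 ≤ (∑ a, |c a|) * ∑ a, |c a| * w a ^ 2 := by
    refine Finset.sum_sq_le_sum_mul_sum_of_sq_le_mul _ (fun a _ => abs_nonneg _)
      (fun a _ => by positivity) fun a _ => le_of_eq ?_
    linear_combination c a ^ 2 * w a ^ 2 * chi_mul_self a x - w a ^ 2 * sq_abs (c a)
  simp only [Pi.zero_apply, mul_zero, Finset.sum_const_zero, zero_add, ne_eq, OfNat.ofNat_ne_zero,
    not_false_eq_true, zero_pow] at he hw
  have hK : 0 ≤ ∑ a, |c a| := Finset.sum_nonneg fun a _ => abs_nonneg _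
  have h1 : (d * γ) ^ 2 ≤ (∑ a, c a * chi a x * w a) ^ 2 := by gcongr
  have h2 : (d * γ) ^ 2 ≤ (∑ a, |c a|) * (d * ∑ a, |c a|) :=
    h1.trans (hcs.trans (by gcongr))
  rcases Nat.eq_zero_or_pos d with rfl | hd
  · simpa using sq_nonneg _
  · have hd' : (0 : ℝ) < d := by exact_mod_cast hd
    refine le_of_mul_le_mul_left ?_ hd'
    nlinarith

lemma splitTree_depth_le_of_approx {n : ℕ} {A : Set (Fin n → ZMod 2)}
    {c : (Fin n → ZMod 2) → ℝ} {ε K : ℝ} (hε : ε ≤ 1 / 2)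
    (hc : ∀ x, |ind A x - ∑ a, c a * chi a x| ≤ ε) (hK : ∑ a, |c a| ≤ K)
    {d : ℕ} {X : Set (Fin n → ZMod 2)} (h : HasSplitTree A d X) :
    d * (1 / 2 - ε) ^ 2 ≤ (K + 1 / 2) ^ 2 := by
  set c' : (Fin n → ZMod 2) → ℝ := fun a => c a - if a = 0 then 1 / 2 else 0 with hc'
  have hval : ∀ x, ∑ a, c' a * chi a x = ∑ a, c a * chi a x - 1 / 2 := by
    intro x
    simp [hc', sub_mul, Finset.sum_sub_distrib]
  have hsum : ∑ a, |c' a| ≤ ∑ a, |c a| + 1 / 2 := by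
    calc ∑ a, |c' a| ≤ ∑ a, (|c a| + if a = 0 then 1 / 2 else 0) := by
          refine Finset.sum_le_sum fun a _ => (abs_sub _ _).trans_eq ?_
          split_ifs <;> norm_num
      _ = _ := by simp [Finset.sum_add_distrib]
  have := splitTree_depth_le (c := c') (γ := 1 / 2 - ε) (by linarith)
    (fun x hx => by
      have := abs_le.1 (hc x)
      simp only [ind, hx, if_true] at this
      rw [hval]; linarith)
    (fun x hx => by
      have := abs_le.1 (hc x)
      simp only [ind, hx, if_false] at this
      rw [hval]; linarith) h
  refine this.trans ?_
  have h0 : 0 ≤ ∑ a, |c' a| := Finset.sum_nonneg fun a _ => abs_nonneg _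
  gcongr
  linarith

lemma affineIndependent_cons_of_sum_ne_zero {n k : ℕ} (a₀ : Fin n → ZMod 2)
    {a : Fin k → Fin n → ZMod 2} (ha : ∀ T : Finset (Fin k), T.Nonempty → ∑ s ∈ T, a s ≠ 0) :
    AffineIndependent (ZMod 2) (Fin.cons a₀ (fun i => a₀ + a i) : Fin (k + 1) → _) := by
  rw [affineIndependent_iff_of_fintype]
  intro w hw hw'
  rw [Finset.univ.weightedVSub_eq_linear_combination hw, Fin.sum_univ_succ] at hw'
  rw [Fin.sum_univ_succ] at hw
  simp only [Fin.cons_zero, Fin.cons_succ, smul_add, Finset.sum_add_distrib] at hw'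
  rw [← Finset.sum_smul, ← add_assoc, ← add_smul, hw, zero_smul, zero_add] at hw'
  have hT : ∑ s ∈ univ with w (Fin.succ s) ≠ 0, a s = 0 := by
    rw [Finset.sum_filter]
    refine Eq.trans ?_ hw'
    refine Finset.sum_congr rfl fun s _ => ?_
    have h2 : ∀ z : ZMod 2, z = 0 ∨ z = 1 := by decide
    rcases h2 (w s.succ) with h | h <;> simp [h]
  have hsucc : ∀ s : Fin k, w s.succ = 0 := by
    intro s
    by_contra hs
    exact ha _ ⟨s, by simpa using hs⟩ hT
  intro i
  refine Fin.cases ?_ hsucc i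
  simpa [hsucc] using hw

lemma exists_add_two_mul_of_kAffineConnected {n k u : ℕ} {A : Set (Fin n → ZMod 2)}
    (hA : KAffineConnected k A) {x : ℕ → Fin n → ZMod 2} {v : Fin n → ZMod 2} {P : ℕ → Prop}
    (hx : ∀ T ⊆ range (u + 1 + k), T.Nonempty → ∑ t ∈ T, x t ≠ 0)
    (hP : ∀ T ⊆ range (u + 1 + k), (v + ∑ t ∈ T, x t ∈ A ↔ P #T)) (hu : P (u + 1)) :
    ∃ j, 1 ≤ j ∧ P (u + 1 + 2 * j) := by
  set a₀ := v + ∑ t ∈ range (u + 1), x t with ha₀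
  set a : Fin k → Fin n → ZMod 2 := fun s => x u + x (u + 1 + s) with ha
  set sh : Fin k ↪ ℕ := ⟨fun s => u + 1 + s, fun s t h => by
    simpa [Fin.ext_iff] using h⟩ with hsh
  have hsh_apply : ∀ s, sh s = u + 1 + s := fun _ => rfl
  have hsh_mem : ∀ (T : Finset (Fin k)) t, t ∈ T.map sh → u + 1 ≤ t ∧ t < u + 1 + k := by
    intro T t ht
    obtain ⟨s, -, rfl⟩ := Finset.mem_map.1 ht
    have := s.2
    rw [hsh_apply]
    omega
  have hsum : ∀ T : Finset (Fin k), ∑ s ∈ T, a s = #T • x u + ∑ t ∈ T.map sh, x t := by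
    intro T
    rw [Finset.sum_map, ha, Finset.sum_add_distrib, Finset.sum_const]
    rfl
  have hodd : ∀ j : ℕ, Odd j → j • x u = x u := by
    rintro j ⟨i, rfl⟩
    rw [add_smul, mul_comm, mul_smul, two_smul, ZModModule.add_self, smul_zero, one_smul, zero_add]
  have heven : ∀ j : ℕ, Even j → j • x u = 0 := by
    rintro j ⟨i, rfl⟩
    rw [add_smul, ZModModule.add_self]
  have hne : ∀ T : Finset (Fin k), T.Nonempty → ∑ s ∈ T, a s ≠ 0 := by
    intro T hT
    rw [hsum]
    rcases Nat.even_or_odd #T with he | ho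
    · rw [heven _ he, zero_add]
      refine hx _ (fun t ht => ?_) (hT.map)
      have := hsh_mem T t ht
      rw [Finset.mem_range]; omega
    · have hu' : u ∉ T.map sh := fun h => by
        have := hsh_mem T u h
        omega
      rw [hodd _ ho, ← Finset.sum_insert hu']
      refine hx _ (fun t ht => ?_) (Finset.insert_nonempty _ _)
      rcases Finset.mem_insert.1 ht with rfl | ht
      · rw [Finset.mem_range]; omega
      · have := hsh_mem T t ht
        rw [Finset.mem_range]; omega
  have hind := affineIndependent_cons_of_sum_ne_zero a₀ hne
  have hbase : a₀ ∈ A := by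
    refine (hP _ ?_).2 (by simpa using hu)
    exact Finset.range_subset_range.2 (by omega)
  have hdisj : ∀ T : Finset (Fin k), Disjoint (range (u + 1)) (T.map sh) := by
    intro T
    rw [Finset.disjoint_left]
    intro t ht ht'
    have := hsh_mem T t ht'
    rw [Finset.mem_range] at ht
    omega
  have hdisj' : ∀ T : Finset (Fin k), Disjoint (range u) (T.map sh) := fun T =>
    (hdisj T).mono_left (Finset.range_subset_range.2 (by omega))
  have hmem : ∀ T : Finset (Fin k),
      (a₀ + ∑ s ∈ T, a s ∈ A ↔ P (u + 1 + 2 * (#T / 2))) := by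
    intro T
    rcases Nat.even_or_odd #T with he | ho
    · rw [hsum, heven _ he, zero_add, ha₀, add_assoc, ← Finset.sum_union (hdisj T), hP]
      · rw [Finset.card_union_of_disjoint (hdisj T), Finset.card_range, Finset.card_map,
          Nat.two_mul_div_two_of_even he]
      · intro t ht
        rw [Finset.mem_union, Finset.mem_range] at ht
        rw [Finset.mem_range]
        rcases ht with ht | ht
        · omega
        · exact (hsh_mem T t ht).2
    · have : a₀ + ∑ s ∈ T, a s = v + ∑ t ∈ range u ∪ T.map sh, x t := by
        rw [hsum, hodd _ ho, ha₀, Finset.sum_range_succ, Finset.sum_union (hdisj' T)]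
        have := ZModModule.add_self (x u)
        linear_combination (exp := 1) this
      rw [this, hP]
      · rw [Finset.card_union_of_disjoint (hdisj' T), Finset.card_range, Finset.card_map]
        obtain ⟨i, hi⟩ := ho
        have : u + 1 + 2 * (#T / 2) = u + #T := by omega
        rw [this]
      · intro t ht
        rw [Finset.mem_union, Finset.mem_range] at ht
        rw [Finset.mem_range]
        rcases ht with ht | ht
        · omega
        · exact (hsh_mem T t ht).2
  have hstep : ∀ i, a₀ + a i ∈ A := fun i => by
    have := (hmem {i}).2 (by simpa using hu)
    simpa using this
  rcases hA a₀ a hbase hstep with h | ⟨T, hT, hTA⟩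
  · exact absurd hind h
  · exact ⟨#T / 2, by omega, (hmem T).1 hTA⟩

lemma card_filter_not_injective_le {u m : ℕ} (hm : 0 < m) (hu : u ≤ m) :
    (#{f : Fin u → Fin m | ¬ Function.Injective f} : ℝ) ≤ u ^ 2 / m * (m : ℝ) ^ u := by
  have hm' : (0 : ℝ) < m := by exact_mod_cast hm
  have hinj : #{f : Fin u → Fin m | Function.Injective f} = m.descFactorial u := by
    rw [← Fintype.card_subtype, ← Fintype.card_congr
      (Equiv.subtypeInjectiveEquivEmbedding (Fin u) (Fin m)).symm, Fintype.card_embedding_eq]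
    simp
  have hsum := Finset.card_filter_add_card_filter_not (s := (univ : Finset (Fin u → Fin m)))
    Function.Injective
  rw [hinj, Finset.card_univ, Fintype.card_fun, Fintype.card_fin, Fintype.card_fin] at hsum
  have hsum' : (m.descFactorial u : ℝ) + #{f : Fin u → Fin m | ¬ Function.Injective f}
      = (m : ℝ) ^ u := by exact_mod_cast hsum
  have hdesc : ((m - u : ℕ) : ℝ) ^ u ≤ m.descFactorial u := by
    have := (Nat.pow_le_pow_left (show m - u ≤ m + 1 - u by omega) u).trans
      (Nat.pow_sub_le_descFactorial m u)
    exact_mod_cast this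
  rw [Nat.cast_sub hu] at hdesc
  have hu' : (u : ℝ) / m ≤ 1 := by
    rw [div_le_one hm']
    exact_mod_cast hu
  have hbern := one_add_mul_le_pow (a := -((u : ℝ) / m)) (by linarith) u
  have hpow : ((m : ℝ) - u) ^ u = (m : ℝ) ^ u * (1 + -((u : ℝ) / m)) ^ u := by
    rw [← mul_pow]
    congr 1
    field_simp
    ring
  have := mul_le_mul_of_nonneg_left hbern (pow_nonneg hm'.le u)
  rw [← hpow] at this
  have hsq : (u : ℝ) ^ 2 / m = u * (u / m) := by ring
  rw [hsq]
  nlinarith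

lemma sum_abs_odd_pow_sub_le {t : ℝ} (ht : |t| ≤ 1) {u : ℕ → ℕ} (hu : StrictMono u)
    (hodd : ∀ i, Odd (u i)) (r : ℕ) :
    ∑ i ∈ range r, |t ^ u i - t ^ u (i + 1)| ≤ 1 := by
  have hterm : ∀ i, |t ^ u i - t ^ u (i + 1)| = |t| ^ u i - |t| ^ u (i + 1) := by
    intro i
    have hle : |t| ^ u (i + 1) ≤ |t| ^ u i :=
      pow_le_pow_of_le_one (abs_nonneg _) ht (hu (Nat.lt_succ_self i)).le
    rcases le_total 0 t with h | h
    · rw [abs_of_nonneg h] at hle ⊢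
      exact abs_of_nonneg (sub_nonneg.2 hle)
    · rw [abs_of_nonpos h] at hle ⊢
      rw [(hodd i).neg_pow, (hodd (i + 1)).neg_pow] at hle ⊢
      rw [abs_of_nonpos (by linarith)]
      ring
  simp only [hterm]
  rw [Finset.sum_range_sub' (fun i => |t| ^ u i)]
  have h1 : |t| ^ u 0 ≤ 1 := pow_le_one₀ (abs_nonneg _) ht
  have h2 : 0 ≤ |t| ^ u r := by positivity
  linarith

lemma sum_fun_eq_sum_mul_pow {n u m : ℕ} (c : (Fin n → ZMod 2) → ℝ) (v : Fin n → ZMod 2)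
    (x : ℕ → Fin n → ZMod 2) :
    ∑ f : Fin u → Fin m, ∑ a, c a * chi a (v + ∑ j, x (f j))
      = ∑ a, c a * chi a v * (∑ i : Fin m, chi a (x i)) ^ u := by
  rw [Finset.sum_comm]
  refine Finset.sum_congr rfl fun a _ => ?_
  rw [Fintype.sum_pow, Finset.mul_sum]
  refine Finset.sum_congr rfl fun f _ => ?_
  rw [chi_add_right, chi_sum, mul_assoc]

lemma abs_average_sub_le {n m u : ℕ} {A : Set (Fin n → ZMod 2)} {c : (Fin n → ZMod 2) → ℝ}
    {ε : ℝ} (hc : ∀ x, |ind A x - ∑ a, c a * chi a x| ≤ ε) {x : ℕ → Fin n → ZMod 2}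
    {v : Fin n → ZMod 2} {P : ℕ → Prop} (hm : 0 < m) (hu : u ≤ m)
    (hP : ∀ T ⊆ range m, (v + ∑ t ∈ T, x t ∈ A ↔ P #T)) :
    |∑ a, c a * chi a v * ((∑ i : Fin m, chi a (x i)) / m) ^ u - if P u then 1 else 0|
      ≤ ε + (u : ℝ) ^ 2 / m := by
  have hm' : (0 : ℝ) < m := by exact_mod_cast hm
  have hpt : ∀ f : Fin u → Fin m,
      |∑ a, c a * chi a (v + ∑ j, x (f j)) - if P u then 1 else 0|
        ≤ ε + if ¬ Function.Injective f then 1 else 0 := by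
    intro f
    have h := hc (v + ∑ j, x (f j))
    rw [abs_sub_comm] at h
    by_cases hf : Function.Injective f
    · have hcard : #(univ.image fun j => ((f j : Fin m) : ℕ)) = u := by
        rw [Finset.card_image_of_injective univ (f := fun j => ((f j : Fin m) : ℕ))
          (Fin.val_injective.comp hf), Finset.card_univ, Fintype.card_fin]
      have := hP (univ.image fun j => ((f j : Fin m) : ℕ)) (fun t ht => by
        obtain ⟨j, -, rfl⟩ := Finset.mem_image.1 ht
        exact Finset.mem_range.2 (f j).2)
      rw [Finset.sum_image fun i _ j _ hij => hf (Fin.val_injective hij), hcard] at this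
      simpa [ind, this, hf] using h
    · have h1 : |ind A (v + ∑ j, x (f j)) - if P u then 1 else 0| ≤ 1 := by
        simp only [ind]
        split_ifs <;> simp
      have := abs_sub_le (∑ a, c a * chi a (v + ∑ j, x (f j))) (ind A (v + ∑ j, x (f j)))
        (if P u then 1 else 0)
      simp only [hf, not_false_eq_true, if_true]
      linarith
  have havg : ∑ a, c a * chi a v * ((∑ i : Fin m, chi a (x i)) / m) ^ u - (if P u then 1 else 0)
      = (∑ f : Fin u → Fin m, (∑ a, c a * chi a (v + ∑ j, x (f j)) - if P u then 1 else 0))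
        / (m : ℝ) ^ u := by
    rw [Finset.sum_sub_distrib, sum_fun_eq_sum_mul_pow, Finset.sum_const, Finset.card_univ,
      Fintype.card_fun, Fintype.card_fin, Fintype.card_fin, sub_div, Finset.sum_div]
    congr 1
    · refine Finset.sum_congr rfl fun a _ => ?_
      rw [div_pow, mul_div_assoc]
    · rw [nsmul_eq_mul]
      push_cast
      field_simp
  rw [havg, abs_div, abs_of_pos (pow_pos hm' u), div_le_iff₀ (pow_pos hm' u)]
  refine (Finset.abs_sum_le_sum_abs _ _).trans ((Finset.sum_le_sum fun f _ => hpt f).trans ?_)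
  rw [Finset.sum_add_distrib, Finset.sum_const, Finset.card_univ, Fintype.card_fun,
    Fintype.card_fin, Fintype.card_fin, Finset.sum_boole, nsmul_eq_mul]
  have := card_filter_not_injective_le hm hu
  push_cast
  linarith

/-- A function of bounded spectral norm cannot alternate many times along the odd layers of a
cube on which it only depends on the layer. -/
lemma alternation_le {n m r L : ℕ} {A : Set (Fin n → ZMod 2)} {c : (Fin n → ZMod 2) → ℝ}
    {ε K : ℝ} (hc : ∀ x, |ind A x - ∑ a, c a * chi a x| ≤ ε) (hK : ∑ a, |c a| ≤ K)
    {x : ℕ → Fin n → ZMod 2} {v : Fin n → ZMod 2} {P : ℕ → Prop} (hm : 0 < m) (hLm : L ≤ m)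
    (hP : ∀ T ⊆ range m, (v + ∑ t ∈ T, x t ∈ A ↔ P #T)) {u : ℕ → ℕ} (hu : StrictMono u)
    (hodd : ∀ i, Odd (u i)) (halt : ∀ i, P (u i) ↔ Even i) (hL : ∀ i ≤ r, u i ≤ L) :
    r * (1 - 2 * ε - 2 * ((L : ℝ) ^ 2 / m)) ≤ K := by
  have hm' : (0 : ℝ) < m := by exact_mod_cast hm
  set t : (Fin n → ZMod 2) → ℝ := fun a => (∑ i : Fin m, chi a (x i)) / m with ht
  have ht1 : ∀ a, |t a| ≤ 1 := by
    intro a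
    rw [ht, abs_div, abs_of_pos hm', div_le_one hm']
    refine (Finset.abs_sum_le_sum_abs _ _).trans ?_
    simp [abs_chi]
  set F : ℕ → ℝ := fun j => ∑ a, c a * chi a v * t a ^ j with hF
  have hF1 : ∀ i ≤ r, |F (u i) - if P (u i) then 1 else 0| ≤ ε + (L : ℝ) ^ 2 / m := by
    intro i hi
    refine (abs_average_sub_le hc hm ((hL i hi).trans hLm) hP).trans ?_
    have : (u i : ℝ) ≤ L := by exact_mod_cast hL i hi
    gcongr
  have hstep : ∀ i ∈ range r, 1 - 2 * ε - 2 * ((L : ℝ) ^ 2 / m) ≤ |F (u i) - F (u (i + 1))| := by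
    intro i hi
    have hi := Finset.mem_range.1 hi
    have h1 := abs_le.1 (hF1 i hi.le)
    have h2 := abs_le.1 (hF1 (i + 1) hi)
    rw [le_abs]
    rcases Nat.even_or_odd i with he | ho
    · simp only [halt, he, Nat.even_add_one, not_true_eq_false, if_true, if_false] at h1 h2
      left; linarith
    · simp only [halt, Nat.not_even_iff_odd.2 ho, Nat.even_add_one, not_false_eq_true,
        if_true, if_false] at h1 h2
      right; linarith
  have hupper : ∑ i ∈ range r, |F (u i) - F (u (i + 1))| ≤ ∑ a, |c a| := by
    calc ∑ i ∈ range r, |F (u i) - F (u (i + 1))|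
        ≤ ∑ i ∈ range r, ∑ a, |c a| * |t a ^ u i - t a ^ u (i + 1)| := by
          refine Finset.sum_le_sum fun i _ => ?_
          rw [hF]
          simp only
          rw [← Finset.sum_sub_distrib]
          refine (Finset.abs_sum_le_sum_abs _ _).trans (Finset.sum_le_sum fun a _ => le_of_eq ?_)
          rw [← mul_sub, abs_mul, abs_mul, abs_chi, mul_one]
      _ = ∑ a, |c a| * ∑ i ∈ range r, |t a ^ u i - t a ^ u (i + 1)| := by
          rw [Finset.sum_comm]
          simp only [Finset.mul_sum]
      _ ≤ ∑ a, |c a| * 1 := by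
          gcongr with a
          exact sum_abs_odd_pow_sub_le (ht1 a) hu hodd r
      _ = ∑ a, |c a| := by simp
  have := Finset.sum_le_sum hstep
  rw [Finset.sum_const, Finset.card_range, nsmul_eq_mul] at this
  linarith

/-- `x 0, …, x (m - 1)` are nondegenerate directions of a cube based at `v` on which membership
in `A` only depends on the layer, as prescribed by `P`. -/
def IsLayeredCube {n : ℕ} (A : Set (Fin n → ZMod 2)) (P : ℕ → Prop) (m : ℕ)
    (x : ℕ → Fin n → ZMod 2) (v : Fin n → ZMod 2) : Prop :=
  (∀ T ⊆ range m, T.Nonempty → ∑ t ∈ T, x t ≠ 0) ∧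
    ∀ T ⊆ range m, (v + ∑ t ∈ T, x t ∈ A ↔ P #T)

lemma exists_strictMono_alternating {P : ℕ → Prop}
    (h : ∀ w, Odd w → ∃ w', w < w' ∧ Odd w' ∧ (P w' ↔ P w)) {i j : ℕ} (hi : Odd i) (hj : Odd j)
    (hij : ¬(P i ↔ P j)) :
    ∃ u : ℕ → ℕ, StrictMono u ∧ (∀ l, Odd (u l)) ∧ ∀ l, P (u l) ↔ Even l := by
  have hrec : ∀ (w : ℕ), Odd w → ∀ N, ∃ w', N < w' ∧ Odd w' ∧ (P w' ↔ P w) := by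
    intro w hw N
    induction N with
    | zero => exact ⟨w, hw.pos, hw, Iff.rfl⟩
    | succ N ih =>
      obtain ⟨w₁, h₁, ho₁, hP₁⟩ := ih
      obtain ⟨w₂, h₂, ho₂, hP₂⟩ := h w₁ ho₁
      exact ⟨w₂, by omega, ho₂, hP₂.trans hP₁⟩
  have key : ∀ N l : ℕ, ∃ w, N < w ∧ Odd w ∧ (P w ↔ Even l) := by
    intro N l
    obtain ⟨w, hw, hPw⟩ : ∃ w, Odd w ∧ (P w ↔ Even l) := by
      by_cases hl : P i ↔ Even l
      · exact ⟨i, hi, hl⟩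
      · exact ⟨j, hj, by tauto⟩
    obtain ⟨w', h', ho, hP⟩ := hrec w hw N
    exact ⟨w', h', ho, hP.trans hPw⟩
  choose f hf hfo hfP using key
  let u : ℕ → ℕ := fun l => Nat.rec (f 0 0) (fun l w => f w (l + 1)) l
  have hu : ∀ l, ∃ N, u l = f N l
    | 0 => ⟨0, rfl⟩
    | l + 1 => ⟨u l, rfl⟩
  refine ⟨u, strictMono_nat_of_lt_succ fun l => hf (u l) (l + 1), fun l => ?_, fun l => ?_⟩
  · obtain ⟨N, hN⟩ := hu l
    exact hN ▸ hfo N l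
  · obtain ⟨N, hN⟩ := hu l
    exact hN ▸ hfP N l

lemma odd_layers_iff {k : ℕ} {ε K : ℝ} (hε : ε < 1 / 2) {P : ℕ → Prop}
    (H : ∀ m, ∃ (n : ℕ) (A : Set (Fin n → ZMod 2)) (c : (Fin n → ZMod 2) → ℝ)
      (x : ℕ → Fin n → ZMod 2) (v : Fin n → ZMod 2),
      (∀ y, |ind A y - ∑ a, c a * chi a y| ≤ ε) ∧ ∑ a, |c a| ≤ K ∧
      KAffineConnected k A ∧ KAffineConnected k Aᶜ ∧ IsLayeredCube A P m x v)
    {i j : ℕ} (hi : Odd i) (hj : Odd j) : P i ↔ P j := by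
  by_contra hij
  have hrec : ∀ w, Odd w → ∃ w', w < w' ∧ Odd w' ∧ (P w' ↔ P w) := by
    rintro w hw
    obtain ⟨u, rfl⟩ : ∃ u, w = u + 1 := ⟨w - 1, by have := hw.pos; omega⟩
    obtain ⟨n, A, c, x, v, -, -, hA, hA', hx, hP⟩ := H (u + 1 + k)
    by_cases hu : P (u + 1)
    · obtain ⟨l, hl, hl'⟩ := exists_add_two_mul_of_kAffineConnected hA hx hP hu
      exact ⟨_, by omega, hw.add_even (even_two_mul l), iff_of_true hl' hu⟩
    · obtain ⟨l, hl, hl'⟩ := exists_add_two_mul_of_kAffineConnected (P := fun i => ¬ P i) hA' hx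
        (fun T hT => not_congr (hP T hT)) hu
      exact ⟨_, by omega, hw.add_even (even_two_mul l), iff_of_false hl' hu⟩
  obtain ⟨u, hu, hodd, halt⟩ := exists_strictMono_alternating hrec hi hj hij
  have hγ : 0 < 1 / 2 - ε := by linarith
  obtain ⟨r, hr⟩ := exists_nat_gt (K / (1 / 2 - ε))
  rw [div_lt_iff₀ hγ] at hr
  obtain ⟨s, hs⟩ := exists_nat_gt (2 * (u r : ℝ) ^ 2 / (1 / 2 - ε))
  rw [div_lt_iff₀ hγ] at hs
  set m := max s (u r + 1) with hm
  have hm0 : 0 < m := by omega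
  have hm0' : (0 : ℝ) < m := by exact_mod_cast hm0
  have hsm : (s : ℝ) ≤ m := by exact_mod_cast le_max_left _ _
  obtain ⟨n, A, c, x, v, hc, hK, -, -, -, hP⟩ := H m
  have := alternation_le (r := r) (L := u r) hc hK hm0 (by omega) hP hu hodd halt
    (fun l hl => hu.monotone hl)
  have hL : 2 * ((u r : ℝ) ^ 2 / m) ≤ 1 / 2 - ε := by
    rw [← mul_div_assoc, div_le_iff₀ hm0']
    nlinarith
  have hr0 : (0 : ℝ) ≤ r := Nat.cast_nonneg r
  nlinarith

/-- The translates of a set `A` by `v`, as `v` ranges over the group. -/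
def translates {G : Type*} [Add G] (A : Set G) : Set (Set G) :=
  Set.range fun v => {x | x + v ∈ A}

/-- The set of all `v` such that `x + v ∈ A` for almost all `x` with respect to `p`. -/
def limitSet {G : Type*} [Add G] (p : Ultrafilter G) (A : Set G) : Set G :=
  {v | ∀ᶠ x in (p : Filter G), x + v ∈ A}

/-- The translations preserving `D`. -/
def stab {G : Type*} [Add G] (D : Set G) : Set G :=
  {h | ∀ v, v + h ∈ D ↔ v ∈ D}

section LimitSet

variable {G : Type*} [AddCommGroup G]

lemma limitSet_univ (p : Ultrafilter G) : limitSet p Set.univ = Set.univ := by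
  simp [limitSet]

lemma limitSet_compl (p : Ultrafilter G) (A : Set G) : limitSet p Aᶜ = (limitSet p A)ᶜ := by
  ext v
  exact Ultrafilter.eventually_not

lemma limitSet_union (p : Ultrafilter G) (A B : Set G) :
    limitSet p (A ∪ B) = limitSet p A ∪ limitSet p B := by
  ext v
  exact Ultrafilter.eventually_or

lemma limitSet_inter (p : Ultrafilter G) (A B : Set G) :
    limitSet p (A ∩ B) = limitSet p A ∩ limitSet p B := by
  ext v
  exact Filter.eventually_and

lemma limitSet_translate (p : Ultrafilter G) (A : Set G) (w : G) :
    limitSet p {x | x + w ∈ A} = {v | v + w ∈ limitSet p A} := by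
  ext v
  simp only [limitSet, Set.mem_ofPred_eq, add_assoc]

lemma zero_mem_limitSet {p : Ultrafilter G} {A : Set G} : 0 ∈ limitSet p A ↔ A ∈ p := by
  simp only [limitSet, Set.mem_ofPred_eq, add_zero]
  rfl

lemma InSetRing.translate {A Z : Set G} (hZ : InSetRing (translates A) Z) (h : G) :
    InSetRing (translates A) {x | x + h ∈ Z} := by
  induction hZ with
  | base hB =>
    obtain ⟨v, rfl⟩ := hB
    exact .base (Set.mem_range.2 ⟨h + v, Set.ext fun x => by simp [add_assoc]⟩)
  | univ => exact .univ
  | compl _ ih => exact ih.compl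
  | union _ _ ih₁ ih₂ => exact ih₁.union ih₂
  | inter _ _ ih₁ ih₂ => exact ih₁.inter ih₂

lemma InSetRing.mem_inter_translate {A Z : Set G} (hZ : InSetRing (translates A) Z) (v : G) :
    InSetRing (translates A) {x | x ∈ Z ∧ x + v ∈ A} :=
  hZ.inter (.base ⟨v, rfl⟩)

lemma InSetRing.mem_diff_translate {A Z : Set G} (hZ : InSetRing (translates A) Z) (v : G) :
    InSetRing (translates A) {x | x ∈ Z ∧ x + v ∉ A} :=
  hZ.inter (show InSetRing (translates A) {x | x + v ∈ A} from .base ⟨v, rfl⟩).compl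

lemma add_mem_limitSet_iff {p : Ultrafilter G} {A Z : Set G} (hZ : InSetRing (translates A) Z)
    {h : G} (hh : h ∈ stab (limitSet p A)) (v : G) :
    v + h ∈ limitSet p Z ↔ v ∈ limitSet p Z := by
  induction hZ generalizing v with
  | base hB =>
    obtain ⟨w, rfl⟩ := hB
    rw [limitSet_translate, Set.mem_ofPred_eq, Set.mem_ofPred_eq, add_right_comm, hh]
  | univ => simp [limitSet_univ]
  | compl _ ih => simp [limitSet_compl, ih]
  | union _ _ ih₁ ih₂ => simp [limitSet_union, ih₁, ih₂]
  | inter _ _ ih₁ ih₂ => simp [limitSet_inter, ih₁, ih₂]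

/-- An operation on sets which is a homomorphism of Boolean algebras and commutes with
translations. -/
structure IsTranslationHom (f : Set G → Set G) : Prop where
  univ : f Set.univ = Set.univ
  compl : ∀ A, f Aᶜ = (f A)ᶜ
  union : ∀ A B, f (A ∪ B) = f A ∪ f B
  inter : ∀ A B, f (A ∩ B) = f A ∩ f B
  translate : ∀ A w, f {x | x + w ∈ A} = {v | v + w ∈ f A}

lemma isTranslationHom_limitSet (p : Ultrafilter G) : IsTranslationHom (limitSet p) :=
  ⟨limitSet_univ p, limitSet_compl p, limitSet_union p, limitSet_inter p, limitSet_translate p⟩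

lemma IsTranslationHom.comp {f g : Set G → Set G} (hf : IsTranslationHom f)
    (hg : IsTranslationHom g) : IsTranslationHom (f ∘ g) := by
  constructor <;> intros <;> simp only [Function.comp_apply]
  · rw [hg.univ, hf.univ]
  · rw [hg.compl, hf.compl]
  · rw [hg.union, hf.union]
  · rw [hg.inter, hf.inter]
  · rw [hg.translate, hf.translate]

lemma IsTranslationHom.eq_of_inSetRing {f g : Set G → Set G} (hf : IsTranslationHom f)
    (hg : IsTranslationHom g) {A Z : Set G} (hA : f A = g A)
    (hZ : InSetRing (translates A) Z) : f Z = g Z := by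
  induction hZ with
  | base hB =>
    obtain ⟨w, rfl⟩ := hB
    rw [hf.translate, hg.translate, hA]
  | univ => rw [hf.univ, hg.univ]
  | compl _ ih => rw [hf.compl, hg.compl, ih]
  | union _ _ ih₁ ih₂ => rw [hf.union, hg.union, ih₁, ih₂]
  | inter _ _ ih₁ ih₂ => rw [hf.inter, hg.inter, ih₁, ih₂]

/-- In the absence of deep split trees, the set `limitSet p A` is definable. -/
lemma exists_limitSet_eq {A : Set G} {d : ℕ} (hd : ¬ HasSplitTree A d Set.univ)
    (p : Ultrafilter G) :
    ∃ r X, InSetRing (translates A) X ∧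
      limitSet p A = {v | HasSplitTree A r {x | x ∈ X ∧ x + v ∈ A}} := by
  have hex : ∃ d X, InSetRing (translates A) X ∧ X ∈ p ∧ ¬ HasSplitTree A d X :=
    ⟨d, Set.univ, .univ, Filter.univ_mem, hd⟩
  obtain ⟨X, hX, hXp, hXd⟩ := Nat.find_spec hex
  have hmin : ∀ r < Nat.find hex, ∀ Y, InSetRing (translates A) Y → Y ∈ p →
      HasSplitTree A r Y := by
    intro r hr Y hY hYp
    by_contra h
    exact Nat.find_min hex hr ⟨Y, hY, hYp, h⟩
  cases hr : Nat.find hex with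
  | zero =>
    rw [hr] at hXd
    exact absurd (Ultrafilter.nonempty_of_mem hXp) hXd
  | succ r =>
    rw [hr] at hXd hmin
    refine ⟨r, X, hX, Set.ext fun v => ⟨fun hv => ?_, fun hv => ?_⟩⟩
    · exact hmin r r.lt_succ_self _ (hX.mem_inter_translate v) (Filter.inter_mem hXp hv)
    · by_contra hv'
      refine hXd ⟨v, hv, hmin r r.lt_succ_self _ (hX.mem_diff_translate v) ?_⟩
      exact Filter.inter_mem hXp (Ultrafilter.eventually_not.2 hv')

lemma exists_limitSet_eq_stab {A : Set G} {d : ℕ} (hd : ¬ HasSplitTree A d Set.univ)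
    (p : Ultrafilter G) :
    ∃ Z, InSetRing (translates A) Z ∧ limitSet p Z = stab (limitSet p A) := by
  by_contra! hne
  have key : ∀ d X, InSetRing (translates A) X → (limitSet p X).Nonempty →
      HasSplitTree A d X := by
    intro d
    induction d with
    | zero =>
      rintro X - ⟨h, hh⟩
      obtain ⟨x, hx⟩ := Filter.Eventually.exists hh
      exact ⟨_, hx⟩
    | succ d ih =>
      rintro X hX ⟨h, hh⟩
      have hX' := hX.translate h
      have h0 : (0 : G) ∈ limitSet p {x | x + h ∈ X} := by
        rw [limitSet_translate, Set.mem_ofPred_eq, zero_add]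
        exact hh
      have hsub : stab (limitSet p A) ⊆ limitSet p {x | x + h ∈ X} := by
        intro s hs
        have := add_mem_limitSet_iff hX' hs 0
        rw [zero_add] at this
        exact this.2 h0
      obtain ⟨h', hh', hs⟩ : ∃ h' ∈ limitSet p {x | x + h ∈ X}, h' ∉ stab (limitSet p A) := by
        by_contra! hsup
        exact hne _ hX' (Set.Subset.antisymm hsup hsub)
      rw [limitSet_translate, Set.mem_ofPred_eq] at hh'
      simp only [stab, Set.mem_ofPred_eq, not_forall] at hs
      obtain ⟨v, hv⟩ := hs
      have e₁ : h' + h + (v - h) = v + h' := by abel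
      have e₂ : h + (v - h) = v := by abel
      have hin : ∀ g, g ∈ limitSet p X → g + (v - h) ∈ limitSet p A →
          HasSplitTree A d {x | x ∈ X ∧ x + (v - h) ∈ A} := fun g hg hg' => by
        refine ih _ (hX.mem_inter_translate _) ⟨g, Filter.Eventually.and hg ?_⟩
        simpa only [limitSet, Set.mem_ofPred_eq, add_assoc] using hg'
      have hout : ∀ g, g ∈ limitSet p X → g + (v - h) ∉ limitSet p A →
          HasSplitTree A d {x | x ∈ X ∧ x + (v - h) ∉ A} := fun g hg hg' => by
        refine ih _ (hX.mem_diff_translate _) ⟨g, Filter.Eventually.and hg ?_⟩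
        simpa only [limitSet, Set.mem_ofPred_eq, add_assoc] using Ultrafilter.eventually_not.2 hg'
      by_cases hvA : v ∈ limitSet p A
      · exact ⟨v - h, hin h hh (by rwa [e₂]), hout _ hh' (by rw [e₁]; tauto)⟩
      · exact ⟨v - h, hin _ hh' (by rw [e₁]; tauto), hout h hh (by rwa [e₂])⟩
  exact hd (key d _ .univ ⟨0, by simp [limitSet_univ]⟩)

lemma limitSet_limitSet_subset {A : Set G} {d : ℕ} (hd : ¬ HasSplitTree A d Set.univ)
    (p q : Ultrafilter G) : limitSet p (limitSet q A) ⊆ limitSet q (limitSet p A) := by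
  intro v hv
  by_contra hv'
  have hv'' : ∀ᶠ y in (q : Filter G), ∀ᶠ x in (p : Filter G), x + (y + v) ∉ A := by
    filter_upwards [Ultrafilter.eventually_not.2 hv'] with y hy
    exact Ultrafilter.eventually_not.2 hy
  have key : ∀ d, ∀ X ∈ p, ∃ F ⊆ X, F.Finite ∧ HasSplitTree A d F := by
    intro d
    induction d with
    | zero =>
      intro X hX
      obtain ⟨x, hx⟩ := Ultrafilter.nonempty_of_mem hX
      exact ⟨{x}, by simpa using hx, Set.finite_singleton x, Set.singleton_nonempty x⟩
    | succ d ih =>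
      intro X hX
      obtain ⟨F₁, hF₁, hfin₁, ht₁⟩ := ih _ (Filter.inter_mem hX hv)
      have hy : ∀ᶠ y in (q : Filter G), ∀ x ∈ F₁, x + (y + v) ∈ A := by
        rw [Filter.eventually_all_finite hfin₁]
        intro x hx
        filter_upwards [(hF₁ hx).2] with y hy
        rwa [← add_assoc, add_comm x y, add_assoc]
      obtain ⟨y, hy, hy'⟩ := (hy.and hv'').exists
      obtain ⟨F₂, hF₂, hfin₂, ht₂⟩ := ih _ (Filter.inter_mem hX hy')
      refine ⟨F₁ ∪ F₂, Set.union_subset (fun x hx => (hF₁ hx).1) (fun x hx => (hF₂ hx).1),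
        hfin₁.union hfin₂, y + v, ht₁.mono fun x hx => ⟨Or.inl hx, hy x hx⟩,
        ht₂.mono fun x hx => ⟨Or.inr hx, (hF₂ hx).2⟩⟩
  obtain ⟨F, -, -, hF⟩ := key d Set.univ Filter.univ_mem
  exact hd (hF.mono (Set.subset_univ _))

lemma limitSet_comm {A : Set G} {d : ℕ} (hd : ¬ HasSplitTree A d Set.univ)
    (p q : Ultrafilter G) : limitSet p (limitSet q A) = limitSet q (limitSet p A) :=
  Set.Subset.antisymm (limitSet_limitSet_subset hd p q) (limitSet_limitSet_subset hd q p)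

lemma zero_mem_stab (D : Set G) : 0 ∈ stab D := fun v => by rw [add_zero]

lemma add_mem_stab {D : Set G} {g h : G} (hg : g ∈ stab D) (hh : h ∈ stab D) :
    g + h ∈ stab D := fun v => by rw [← add_assoc, hh, hg]

lemma exists_add_mem_stab {A : Set G} {d : ℕ} (hd : ¬ HasSplitTree A d Set.univ)
    {p : Ultrafilter G} (hp : limitSet p (limitSet p (limitSet p A)) = limitSet p A) :
    ∃ c, ∀ᶠ y in (p : Filter G), y + c ∈ stab (limitSet p A) := by
  obtain ⟨Z, hZ, hZs⟩ := exists_limitSet_eq_stab hd p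
  have hL := isTranslationHom_limitSet p
  have h3 : limitSet p (limitSet p (limitSet p Z)) = limitSet p Z :=
    (hL.comp (hL.comp hL)).eq_of_inSetRing hL hp hZ
  rw [hZs] at h3
  have h0 := zero_mem_stab (limitSet p A)
  rw [← h3] at h0
  obtain ⟨c, hc⟩ := Filter.Eventually.exists h0
  exact ⟨_, hc⟩

lemma mem_iff_of_cosets [Module (ZMod 2) G] {A : Set G} {d : ℕ}
    (hd : ¬ HasSplitTree A d Set.univ) {p q : Ultrafilter G} {c e : G}
    (hcq : ∀ᶠ y in (q : Filter G), y + c ∈ stab (limitSet p A))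
    (hep : ∀ᶠ y in (p : Filter G), y + e ∈ stab (limitSet q A))
    (heq : ∀ᶠ y in (q : Filter G), y + e ∈ stab (limitSet q A)) : A ∈ p ↔ A ∈ q := by
  have htwo : ∀ a b c : G, a + b + (a + c) = b + c := fun a b c => by
    rw [add_add_add_comm, ZModModule.add_self, zero_add]
  have hsub : stab (limitSet p A) ⊆ stab (limitSet q A) := by
    intro h hh
    obtain ⟨Z, hZ, hZs⟩ := exists_limitSet_eq_stab hd q
    have hp := isTranslationHom_limitSet p
    have hq := isTranslationHom_limitSet q
    have hcomm : limitSet p (limitSet q Z) = limitSet q (limitSet p Z) :=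
      (hp.comp hq).eq_of_inSetRing (hq.comp hp) (limitSet_comm hd p q) hZ
    have he : e ∈ limitSet q (limitSet p Z) := by
      rw [← hcomm, hZs]
      exact hep
    have heh : e + h ∈ limitSet p (limitSet q Z) := by
      rw [hcomm]
      filter_upwards [he] with y hy
      rw [← add_assoc, add_mem_limitSet_iff hZ hh]
      exact hy
    rw [hZs] at heh
    obtain ⟨y, hy, hy'⟩ := (hep.and heh).exists
    have := add_mem_stab hy hy'
    rwa [← add_assoc y e h, add_comm (y + e), add_comm (y + e) h, add_assoc,
      ZModModule.add_self, add_zero] at this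
  have hce : c + e ∈ stab (limitSet q A) := by
    obtain ⟨y, hy, hy'⟩ := (hcq.and heq).exists
    have := add_mem_stab (hsub hy) hy'
    rwa [htwo] at this
  have hshift : ∀ (p' q' : Ultrafilter G) (b v : G),
      (∀ᶠ y in (q' : Filter G), y + b ∈ stab (limitSet p' A)) →
      (v ∈ limitSet q' (limitSet p' A) ↔ b + v ∈ limitSet p' A) := by
    intro p' q' b v hb
    rw [← Filter.eventually_const (f := (q' : Filter G)) (p := b + v ∈ limitSet p' A)]
    refine Filter.eventually_congr ?_
    filter_upwards [hb] with y hy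
    rw [← hy (y + v), add_comm y v, add_assoc, ← add_assoc y, ZModModule.add_self, zero_add,
      add_comm]
  rw [← zero_mem_limitSet, ← zero_mem_limitSet, ← ZModModule.add_self c, ← hshift p q c c hcq,
    ← limitSet_comm hd, hshift q p e c hep, ZModModule.add_self, add_comm]
  have := hce 0
  rwa [zero_add] at this

lemma exists_ultrafilter_pair {α : Type*} {𝒢 : Set (Set α)} (hcompl : ∀ Y ∈ 𝒢, Yᶜ ∈ 𝒢)
    (hinter : ∀ Y ∈ 𝒢, ∀ Z ∈ 𝒢, Y ∩ Z ∈ 𝒢) (huniv : Set.univ ∈ 𝒢) {A : Set α} (hA : A ∉ 𝒢) :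
    ∃ p q : Ultrafilter α, A ∈ p ∧ A ∉ q ∧ ∀ Y ∈ 𝒢, Y ∈ p → Y ∈ q := by
  let F : Filter α :=
    { sets := {S | ∃ Y ∈ 𝒢, Aᶜ ⊆ Y ∧ A ∩ Y ⊆ S}
      univ_sets := ⟨Set.univ, huniv, Set.subset_univ _, Set.subset_univ _⟩
      sets_of_superset := fun ⟨Y, hY, hAY, hYS⟩ hST => ⟨Y, hY, hAY, hYS.trans hST⟩
      inter_sets := fun ⟨Y, hY, hAY, hYS⟩ ⟨Z, hZ, hAZ, hZT⟩ =>
        ⟨Y ∩ Z, hinter Y hY Z hZ, Set.subset_inter hAY hAZ, fun x hx =>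
          ⟨hYS ⟨hx.1, hx.2.1⟩, hZT ⟨hx.1, hx.2.2⟩⟩⟩ }
  have hF : F.NeBot := by
    refine ⟨fun h => ?_⟩
    obtain ⟨Y, hY, hAY, hYe⟩ : ∅ ∈ F := h ▸ Filter.mem_bot
    refine hA ?_
    have : A = Yᶜ := by
      refine Set.Subset.antisymm (fun x hx hxY => hYe ⟨hx, hxY⟩) ?_
      rwa [Set.compl_subset_comm]
    exact this ▸ hcompl Y hY
  let p := Ultrafilter.of F
  have hp : ∀ S ∈ F, S ∈ p := fun S hS => Ultrafilter.of_le F hS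
  have hpsub : ∀ Y ∈ 𝒢, Y ∈ p → ¬ Y ⊆ A := by
    intro Y hY hYp hYA
    have : Yᶜ ∈ p := hp _ ⟨Yᶜ, hcompl Y hY, Set.compl_subset_compl.2 hYA, Set.inter_subset_right⟩
    exact Ultrafilter.compl_mem_iff_notMem.1 this hYp
  let E : Filter α :=
    { sets := {S | ∃ Y ∈ 𝒢, Y ∈ p ∧ Y \ A ⊆ S}
      univ_sets := ⟨Set.univ, huniv, Filter.univ_mem, Set.subset_univ _⟩
      sets_of_superset := fun ⟨Y, hY, hYp, hYS⟩ hST => ⟨Y, hY, hYp, hYS.trans hST⟩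
      inter_sets := fun ⟨Y, hY, hYp, hYS⟩ ⟨Z, hZ, hZp, hZT⟩ =>
        ⟨Y ∩ Z, hinter Y hY Z hZ, Filter.inter_mem hYp hZp, fun x hx =>
          ⟨hYS ⟨hx.1.1, hx.2⟩, hZT ⟨hx.1.2, hx.2⟩⟩⟩ }
  have hE : E.NeBot := by
    refine ⟨fun h => ?_⟩
    obtain ⟨Y, hY, hYp, hYe⟩ : ∅ ∈ E := h ▸ Filter.mem_bot
    exact hpsub Y hY hYp (Set.sdiff_eq_empty.1 (Set.subset_empty_iff.1 hYe))
  refine ⟨p, Ultrafilter.of E, hp _ ⟨Set.univ, huniv, Set.subset_univ _, Set.inter_subset_left⟩,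
    ?_, fun Y hY hYp => Ultrafilter.of_le E ⟨Y, hY, hYp, Set.sdiff_subset⟩⟩
  refine Ultrafilter.compl_mem_iff_notMem.1 (Ultrafilter.of_le E ?_)
  exact ⟨Set.univ, huniv, Filter.univ_mem, fun x hx => hx.2⟩

/-- A set without deep split trees all of whose types are concentrated on cosets of their
stabilisers belongs to every algebra of sets containing these cosets. -/
theorem mem_of_cosets_mem [Module (ZMod 2) G] {A : Set G} {d : ℕ}
    (hd : ¬ HasSplitTree A d Set.univ) {𝒢 : Set (Set G)} (hcompl : ∀ Y ∈ 𝒢, Yᶜ ∈ 𝒢)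
    (hinter : ∀ Y ∈ 𝒢, ∀ Z ∈ 𝒢, Y ∩ Z ∈ 𝒢) (huniv : Set.univ ∈ 𝒢)
    (hcoset : ∀ (p : Ultrafilter G) (c : G), {y | y + c ∈ stab (limitSet p A)} ∈ 𝒢)
    (hcube : ∀ p : Ultrafilter G,
      limitSet p (limitSet p (limitSet p A)) = limitSet p A) : A ∈ 𝒢 := by
  by_contra hA
  obtain ⟨p, q, hp, hq, hpq⟩ := exists_ultrafilter_pair hcompl hinter huniv hA
  have hqp : ∀ Y ∈ 𝒢, Y ∈ q → Y ∈ p := fun Y hY hYq => by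
    by_contra hYp
    exact Ultrafilter.compl_mem_iff_notMem.1
      (hpq _ (hcompl Y hY) (Ultrafilter.compl_mem_iff_notMem.2 hYp)) hYq
  obtain ⟨c, hc⟩ := exists_add_mem_stab hd (hcube p)
  obtain ⟨e, he⟩ := exists_add_mem_stab hd (hcube q)
  exact hq ((mem_iff_of_cosets hd (hpq _ (hcoset p c) hc) (hqp _ (hcoset q e) he) he).1 hp)

end LimitSet

lemma InSetRing.mono {α : Type*} {S T : Set (Set α)} (hST : S ⊆ T) {A : Set α}
    (hA : InSetRing S A) : InSetRing T A := by
  induction hA with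
  | base h => exact .base (hST h)
  | univ => exact .univ
  | compl _ ih => exact ih.compl
  | union _ _ ih₁ ih₂ => exact ih₁.union ih₂
  | inter _ _ ih₁ ih₂ => exact ih₁.inter ih₂

lemma CosetCplxLe.mono {n ℓ ℓ' : ℕ} {A : Set (Fin n → ZMod 2)} (h : CosetCplxLe A ℓ)
    (hℓ : ℓ ≤ ℓ') : CosetCplxLe A ℓ' := by
  obtain ⟨t, C, ht, hC, hA⟩ := h
  exact ⟨t, C, ht.trans hℓ, hC, hA⟩

lemma cosetCplxLe_univ (n : ℕ) : CosetCplxLe (Set.univ : Set (Fin n → ZMod 2)) 0 :=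
  ⟨0, Fin.elim0, le_rfl, fun i => i.elim0, .univ⟩

lemma CosetCplxLe.compl {n ℓ : ℕ} {A : Set (Fin n → ZMod 2)} (h : CosetCplxLe A ℓ) :
    CosetCplxLe Aᶜ ℓ := by
  obtain ⟨t, C, ht, hC, hA⟩ := h
  exact ⟨t, C, ht, hC, hA.compl⟩

lemma CosetCplxLe.inter {n ℓ ℓ' : ℕ} {A B : Set (Fin n → ZMod 2)} (hA : CosetCplxLe A ℓ)
    (hB : CosetCplxLe B ℓ') : CosetCplxLe (A ∩ B) (ℓ + ℓ') := by
  obtain ⟨t, C, ht, hC, hA⟩ := hA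
  obtain ⟨s, E, hs, hE, hB⟩ := hB
  refine ⟨t + s, Fin.append C E, add_le_add ht hs, fun i => ?_, (hA.mono ?_).inter (hB.mono ?_)⟩
  · induction i using Fin.addCases with
    | left i => rw [Fin.append_left]; exact hC i
    | right i => rw [Fin.append_right]; exact hE i
  · rintro _ ⟨i, rfl⟩
    exact ⟨Fin.castAdd s i, Fin.append_left C E i⟩
  · rintro _ ⟨i, rfl⟩
    exact ⟨Fin.natAdd t i, Fin.append_right C E i⟩

lemma IsCoset.cosetCplxLe {n : ℕ} {A : Set (Fin n → ZMod 2)} (hA : IsCoset A) :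
    CosetCplxLe A 1 :=
  ⟨1, fun _ => A, le_rfl, fun _ => hA, .base ⟨0, rfl⟩⟩

lemma isCoset_stab {n : ℕ} (D : Set (Fin n → ZMod 2)) (c : Fin n → ZMod 2) :
    IsCoset {y | y + c ∈ stab D} := by
  have hsmul : ∀ (r : ZMod 2) {x : Fin n → ZMod 2}, x ∈ stab D → r • x ∈ stab D := by
    intro r x hx
    have h2 : ∀ z : ZMod 2, z = 0 ∨ z = 1 := by decide
    rcases h2 r with rfl | rfl
    · rw [zero_smul]
      exact zero_mem_stab D
    · rwa [one_smul]
  let W : Submodule (ZMod 2) (Fin n → ZMod 2) :=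
    { carrier := stab D
      add_mem' := add_mem_stab
      zero_mem' := zero_mem_stab D
      smul_mem' := fun r _ hx => hsmul r hx }
  refine ⟨W, c, ?_⟩
  ext y
  rw [Set.mem_ofPred_eq, Set.mem_ofPred_eq, ZModModule.sub_eq_add]
  rfl

section Internal

variable {d : ℕ → ℕ} {U : Ultrafilter ℕ}

/-- The internal subset of the product determined by a sequence of sets, relative to an
ultrafilter. -/
def internal (U : Ultrafilter ℕ) (X : ∀ i, Set (Fin (d i) → ZMod 2)) :
    Set (∀ i, Fin (d i) → ZMod 2) :=
  {x | ∀ᶠ i in (U : Filter ℕ), x i ∈ X i}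

lemma internal_univ : internal U (fun i => (Set.univ : Set (Fin (d i) → ZMod 2))) = Set.univ := by
  simp [internal]

lemma internal_compl (X : ∀ i, Set (Fin (d i) → ZMod 2)) :
    internal U (fun i => (X i)ᶜ) = (internal U X)ᶜ := by
  ext x
  exact Ultrafilter.eventually_not

lemma internal_union (X Y : ∀ i, Set (Fin (d i) → ZMod 2)) :
    internal U (fun i => X i ∪ Y i) = internal U X ∪ internal U Y := by
  ext x
  exact Ultrafilter.eventually_or

lemma internal_inter (X Y : ∀ i, Set (Fin (d i) → ZMod 2)) :
    internal U (fun i => X i ∩ Y i) = internal U X ∩ internal U Y := by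
  ext x
  exact Filter.eventually_and

lemma internal_congr {X Y : ∀ i, Set (Fin (d i) → ZMod 2)}
    (h : ∀ᶠ i in (U : Filter ℕ), X i = Y i) : internal U X = internal U Y := by
  ext x
  refine Filter.eventually_congr ?_
  filter_upwards [h] with i hi
  rw [hi]

lemma internal_eq_iff {X Y : ∀ i, Set (Fin (d i) → ZMod 2)} :
    internal U X = internal U Y ↔ ∀ᶠ i in (U : Filter ℕ), X i = Y i := by
  refine ⟨fun h => ?_, internal_congr⟩
  by_contra hne
  have hne' : ∀ᶠ i in (U : Filter ℕ), ∃ x, ¬ (x ∈ X i ↔ x ∈ Y i) := by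
    filter_upwards [Ultrafilter.eventually_not.2 hne] with i hi
    by_contra! hi'
    exact hi (Set.ext hi')
  obtain ⟨x, hx⟩ := Filter.skolem.1 hne'
  have hxy : x ∈ internal U X ↔ x ∈ internal U Y := by rw [h]
  by_cases hX : x ∈ internal U X
  · obtain ⟨i, hi, hi₁, hi₂⟩ := (hx.and (hX.and (hxy.1 hX))).exists
    exact hi (iff_of_true hi₁ hi₂)
  · have hY := fun h => hX (hxy.2 h)
    obtain ⟨i, hi, hi₁, hi₂⟩ := (hx.and ((Ultrafilter.eventually_not.2 hX).and
      (Ultrafilter.eventually_not.2 hY))).exists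
    exact hi (iff_of_false hi₁ hi₂)

lemma hasSplitTree_internal_iff {A X : ∀ i, Set (Fin (d i) → ZMod 2)} {r : ℕ} :
    HasSplitTree (internal U A) r (internal U X) ↔
      ∀ᶠ i in (U : Filter ℕ), HasSplitTree (A i) r (X i) := by
  induction r generalizing X with
  | zero => exact Filter.skolem.symm
  | succ r ih =>
    have hpos : ∀ v : ∀ i, Fin (d i) → ZMod 2, {x | x ∈ internal U X ∧ x + v ∈ internal U A}
        = internal U fun i => {x | x ∈ X i ∧ x + v i ∈ A i} := fun v => by
      ext x
      exact Filter.eventually_and.symm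
    have hneg : ∀ v : ∀ i, Fin (d i) → ZMod 2, {x | x ∈ internal U X ∧ x + v ∉ internal U A}
        = internal U fun i => {x | x ∈ X i ∧ x + v i ∉ A i} := fun v => by
      ext x
      exact (and_congr Iff.rfl Ultrafilter.eventually_not.symm).trans Filter.eventually_and.symm
    simp only [HasSplitTree, Filter.skolem, hpos, hneg, ih, Filter.eventually_and]

lemma exists_internal_of_inSetRing {A : ∀ i, Set (Fin (d i) → ZMod 2)}
    {Z : Set (∀ i, Fin (d i) → ZMod 2)} (hZ : InSetRing (translates (internal U A)) Z) :
    ∃ Y, Z = internal U Y := by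
  induction hZ with
  | base h =>
    obtain ⟨v, rfl⟩ := h
    exact ⟨fun i => {x | x + v i ∈ A i}, rfl⟩
  | univ => exact ⟨_, internal_univ.symm⟩
  | compl _ ih =>
    obtain ⟨Y, rfl⟩ := ih
    exact ⟨_, (internal_compl Y).symm⟩
  | union _ _ ih₁ ih₂ =>
    obtain ⟨Y₁, rfl⟩ := ih₁
    obtain ⟨Y₂, rfl⟩ := ih₂
    exact ⟨_, (internal_union Y₁ Y₂).symm⟩
  | inter _ _ ih₁ ih₂ =>
    obtain ⟨Y₁, rfl⟩ := ih₁
    obtain ⟨Y₂, rfl⟩ := ih₂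
    exact ⟨_, (internal_inter Y₁ Y₂).symm⟩

lemma exists_internal_limitSet {A : ∀ i, Set (Fin (d i) → ZMod 2)} {r : ℕ}
    (hr : ¬ HasSplitTree (internal U A) r Set.univ) (p : Ultrafilter (∀ i, Fin (d i) → ZMod 2)) :
    ∃ D, limitSet p (internal U A) = internal U D := by
  obtain ⟨s, X, hX, hD⟩ := exists_limitSet_eq hr p
  obtain ⟨Y, rfl⟩ := exists_internal_of_inSetRing hX
  refine ⟨fun i => {v | HasSplitTree (A i) s {x | x ∈ Y i ∧ x + v ∈ A i}}, ?_⟩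
  rw [hD]
  ext v
  refine Iff.trans (iff_of_eq ?_) (hasSplitTree_internal_iff
    (X := fun i => {x | x ∈ Y i ∧ x + v i ∈ A i}))
  rw [Set.mem_ofPred_eq]
  congr 1
  ext x
  exact Filter.eventually_and.symm

lemma stab_internal (D : ∀ i, Set (Fin (d i) → ZMod 2)) :
    stab (internal U D) = internal U fun i => stab (D i) := by
  ext h
  have : h ∈ stab (internal U D) ↔
      internal U (fun i => {v | v + h i ∈ D i}) = internal U D := by
    rw [Set.ext_iff]
    rfl
  rw [this, internal_eq_iff]
  refine Filter.eventually_congr (Filter.Eventually.of_forall fun i => ?_)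
  rw [Set.ext_iff]
  rfl

/-- The internal sets given by sequences of sets of bounded coset complexity. -/
def boundedCplx (U : Ultrafilter ℕ) (d : ℕ → ℕ) : Set (Set (∀ i, Fin (d i) → ZMod 2)) :=
  {Y | ∃ (ℓ : ℕ) (X : ∀ i, Set (Fin (d i) → ZMod 2)), Y = internal U X ∧ ∀ i, CosetCplxLe (X i) ℓ}

lemma internal_mem_boundedCplx_of_cube {A : ∀ i, Set (Fin (d i) → ZMod 2)} {r : ℕ}
    (hr : ¬ HasSplitTree (internal U A) r Set.univ)
    (hcube : ∀ p : Ultrafilter (∀ i, Fin (d i) → ZMod 2),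
      limitSet p (limitSet p (limitSet p (internal U A))) = limitSet p (internal U A)) :
    internal U A ∈ boundedCplx U d := by
  refine mem_of_cosets_mem hr ?_ ?_ ?_ (fun p c => ?_) hcube
  · rintro _ ⟨ℓ, X, rfl, hX⟩
    exact ⟨ℓ, _, (internal_compl X).symm, fun i => (hX i).compl⟩
  · rintro _ ⟨ℓ, X, rfl, hX⟩ _ ⟨ℓ', X', rfl, hX'⟩
    exact ⟨ℓ + ℓ', _, (internal_inter X X').symm, fun i => (hX i).inter (hX' i)⟩
  · exact ⟨0, _, internal_univ.symm, fun i => cosetCplxLe_univ _⟩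
  · obtain ⟨D, hD⟩ := exists_internal_limitSet hr p
    refine ⟨1, fun i => {y | y + c i ∈ stab (D i)}, ?_, fun i => (isCoset_stab _ _).cosetCplxLe⟩
    rw [hD, stab_internal]
    rfl

/-- The sequences that are almost everywhere zero. -/
def null (U : Ultrafilter ℕ) (d : ℕ → ℕ) : Set (∀ i, Fin (d i) → ZMod 2) :=
  {z | ∀ᶠ i in (U : Filter ℕ), z i = 0}

lemma null_subset_stab_internal (A : ∀ i, Set (Fin (d i) → ZMod 2)) :
    null U d ⊆ stab (internal U A) := by
  intro z hz v
  refine Filter.eventually_congr ?_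
  filter_upwards [hz] with i hi
  rw [Pi.add_apply, hi, add_zero]

lemma stab_subset_stab_limitSet {G : Type*} [AddCommGroup G] (p : Ultrafilter G) (A : Set G) :
    stab A ⊆ stab (limitSet p A) := by
  intro h hh v
  refine Filter.eventually_congr (Filter.Eventually.of_forall fun x => ?_)
  rw [← add_assoc, hh]

lemma limitSet_of_eventually_add_mem_stab {G : Type*} [AddCommGroup G] [Module (ZMod 2) G]
    {p : Ultrafilter G} {A : Set G} {x₀ : G} (h : ∀ᶠ x in (p : Filter G), x + x₀ ∈ stab A) :
    limitSet p A = {v | x₀ + v ∈ A} := by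
  ext v
  rw [Set.mem_ofPred_eq, ← Filter.eventually_const (f := (p : Filter G)) (p := x₀ + v ∈ A)]
  refine Filter.eventually_congr ?_
  filter_upwards [h] with x hx
  rw [← hx (x₀ + v)]
  have : x₀ + v + (x + x₀) = x + v := by
    rw [add_comm x x₀, add_add_add_comm, ZModModule.add_self, zero_add, add_comm]
  rw [this]

/-- Independent sampling from `p` produces cubes on which membership in the iterated limit sets
only depends on the layer. -/
lemma exists_cube {G : Type*} [AddCommGroup G] [Module (ZMod 2) G] {p : Ultrafilter G} {N A : Set G}
    (hp : ∀ x₀, ∀ᶠ x in (p : Filter G), x + x₀ ∉ N) (v : G) (m L : ℕ) :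
    ∃ x : ℕ → G, (∀ T ⊆ range m, T.Nonempty → ∑ t ∈ T, x t ∉ N) ∧
      ∀ T ⊆ range m, ∀ j ≤ L, (v + ∑ t ∈ T, x t ∈ (limitSet p)^[j] A ↔
        v ∈ (limitSet p)^[j + #T] A) := by
  induction m generalizing L with
  | zero =>
    refine ⟨0, fun T hT hT' => ?_, fun T hT j _ => ?_⟩
    · rw [Finset.range_zero, Finset.subset_empty] at hT
      exact absurd hT hT'.ne_empty
    · rw [Finset.range_zero, Finset.subset_empty] at hT
      simp [hT]
  | succ m ih =>
    obtain ⟨x, hxN, hx⟩ := ih (L + 1)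
    have hN : ∀ᶠ y in (p : Filter G), ∀ T ∈ (range m).powerset, y + ∑ t ∈ T, x t ∉ N :=
      (Filter.eventually_all_finset _).2 fun T _ => hp _
    have hW : ∀ᶠ y in (p : Filter G), ∀ T ∈ (range m).powerset, ∀ j ∈ range (L + 1),
        (y + (v + ∑ t ∈ T, x t) ∈ (limitSet p)^[j] A ↔
          v + ∑ t ∈ T, x t ∈ (limitSet p)^[j + 1] A) := by
      refine (Filter.eventually_all_finset _).2 fun T _ => (Filter.eventually_all_finset _).2
        fun j _ => ?_
      rw [Function.iterate_succ_apply']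
      by_cases h : v + ∑ t ∈ T, x t ∈ limitSet p ((limitSet p)^[j] A)
      · filter_upwards [h] with y hy using iff_of_true hy h
      · filter_upwards [Ultrafilter.eventually_not.2 h] with y hy using iff_of_false hy h
    obtain ⟨y, hyN, hyW⟩ := (hN.and hW).exists
    have hsum : ∀ T ⊆ range m, ∑ t ∈ T, Function.update x m y t = ∑ t ∈ T, x t := by
      intro T hT
      refine Finset.sum_congr rfl fun t ht => Function.update_of_ne ?_ _ _
      exact (Finset.mem_range.1 (hT ht)).ne
    have hsplit : ∀ T ⊆ range (m + 1), T ⊆ range m ∨ ∃ S ⊆ range m, m ∉ S ∧ T = insert m S := by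
      intro T hT
      rw [Finset.range_add_one] at hT
      by_cases hm : m ∈ T
      · refine Or.inr ⟨T.erase m, ?_, Finset.notMem_erase m T, (Finset.insert_erase hm).symm⟩
        exact Finset.subset_insert_iff.1 hT
      · exact Or.inl ((Finset.subset_insert_iff_of_notMem hm).1 hT)
    refine ⟨Function.update x m y, fun T hT hne => ?_, fun T hT j hj => ?_⟩
    · rcases hsplit T hT with hT | ⟨S, hS, hmS, rfl⟩
      · rw [hsum T hT]
        exact hxN T hT hne
      · rw [Finset.sum_insert hmS, hsum S hS, Function.update_self]
        exact hyN S (Finset.mem_powerset.2 hS)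
    · rcases hsplit T hT with hT | ⟨S, hS, hmS, rfl⟩
      · rw [hsum T hT]
        exact hx T hT j (by omega)
      · rw [Finset.sum_insert hmS, hsum S hS, Function.update_self, Finset.card_insert_of_notMem hmS,
          add_left_comm, hyW S (Finset.mem_powerset.2 hS) j (Finset.mem_range.2 (by omega)),
          hx S hS (j + 1) (by omega), add_right_comm, add_assoc]

lemma limitSet_cube {k : ℕ} {ε K : ℝ} (hε : ε < 1 / 2) {A : ∀ i, Set (Fin (d i) → ZMod 2)}
    (happrox : ∀ i, ∃ c : (Fin (d i) → ZMod 2) → ℝ, ∑ a, |c a| ≤ K ∧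
      ∀ y, |ind (A i) y - ∑ a, c a * chi a y| ≤ ε)
    (hA : ∀ i, KAffineConnected k (A i)) (hA' : ∀ i, KAffineConnected k (A i)ᶜ)
    (p : Ultrafilter (∀ i, Fin (d i) → ZMod 2)) :
    limitSet p (limitSet p (limitSet p (internal U A))) = limitSet p (internal U A) := by
  by_cases hp : ∃ x₀, ∀ᶠ x in (p : Filter _), x + x₀ ∈ null U d
  · obtain ⟨x₀, hx₀⟩ := hp
    have h₀ := null_subset_stab_internal (U := U) A
    have h₁ := h₀.trans (stab_subset_stab_limitSet p _)
    have h₂ := h₁.trans (stab_subset_stab_limitSet p _)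
    rw [limitSet_of_eventually_add_mem_stab (hx₀.mono fun x hx => h₂ hx),
      limitSet_of_eventually_add_mem_stab (hx₀.mono fun x hx => h₁ hx)]
    ext v
    rw [Set.mem_ofPred_eq, Set.mem_ofPred_eq, ← add_assoc, ZModModule.add_self, zero_add]
  · simp only [not_exists, ← Ultrafilter.eventually_not] at hp
    ext v
    refine odd_layers_iff (P := fun j => v ∈ (limitSet p)^[j] (internal U A)) (k := k) (K := K)
      hε (fun m => ?_) (i := 3) (j := 1) (by decide) (by decide)
    obtain ⟨x, hxN, hx⟩ := exists_cube (A := internal U A) hp v m 0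
    have hne : ∀ᶠ i in (U : Filter ℕ), ∀ T ∈ (range m).powerset, T.Nonempty →
        ∑ t ∈ T, x t i ≠ 0 := by
      refine (Filter.eventually_all_finset _).2 fun T hT => ?_
      by_cases hT' : T.Nonempty
      · filter_upwards [Ultrafilter.eventually_not.2 (hxN T (Finset.mem_powerset.1 hT) hT')]
          with i hi _
        rwa [Finset.sum_apply] at hi
      · exact Filter.Eventually.of_forall fun i h => absurd h hT'
    have hmem : ∀ᶠ i in (U : Filter ℕ), ∀ T ∈ (range m).powerset,
        (v i + ∑ t ∈ T, x t i ∈ A i ↔ v ∈ (limitSet p)^[#T] (internal U A)) := by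
      refine (Filter.eventually_all_finset _).2 fun T hT => ?_
      have h := hx T (Finset.mem_powerset.1 hT) 0 le_rfl
      rw [zero_add, Function.iterate_zero, id] at h
      by_cases hv : v ∈ (limitSet p)^[#T] (internal U A)
      · filter_upwards [h.2 hv] with i hi
        rw [Pi.add_apply, Finset.sum_apply] at hi
        exact iff_of_true hi hv
      · filter_upwards [Ultrafilter.eventually_not.2 fun h' => hv (h.1 h')] with i hi
        rw [Pi.add_apply, Finset.sum_apply] at hi
        exact iff_of_false hi hv
    obtain ⟨i, hi, hi'⟩ := (hne.and hmem).exists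
    obtain ⟨c, hK, hc⟩ := happrox i
    exact ⟨d i, A i, c, fun t => x t i, v i, hc, hK, hA i, hA' i,
      fun T hT => hi T (Finset.mem_powerset.2 hT), fun T hT => hi' T (Finset.mem_powerset.2 hT)⟩

end Internal

theorem exists_cosetCplx_bound (k : ℕ) {ε K : ℝ} (hε : ε < 1 / 2) :
    ∃ ℓ : ℕ, ∀ (n : ℕ) (A : Set (Fin n → ZMod 2)),
      (∃ c : (Fin n → ZMod 2) → ℝ, ∑ a, |c a| ≤ K ∧ ∀ y, |ind A y - ∑ a, c a * chi a y| ≤ ε) →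
      KAffineConnected k A → KAffineConnected k Aᶜ → CosetCplxLe A ℓ := by
  by_contra! hcon
  choose d A happrox hA hA' hcplx using hcon
  let U : Ultrafilter ℕ := Filter.hyperfilter ℕ
  have hγ : 0 < (1 / 2 - ε) ^ 2 := pow_pos (by linarith) 2
  obtain ⟨r, hr⟩ := exists_nat_gt ((K + 1 / 2) ^ 2 / (1 / 2 - ε) ^ 2)
  rw [div_lt_iff₀ hγ] at hr
  have htree : ¬ HasSplitTree (internal U A) r Set.univ := by
    rw [← internal_univ (U := U), hasSplitTree_internal_iff]
    intro h
    obtain ⟨i, hi⟩ := h.exists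
    obtain ⟨c, hK, hc⟩ := happrox i
    exact hr.not_ge (splitTree_depth_le_of_approx hε.le hc hK hi)
  obtain ⟨ℓ, X, hX, hXℓ⟩ := internal_mem_boundedCplx_of_cube htree
    (limitSet_cube hε happrox hA hA')
  have hlarge : ∀ᶠ i in (U : Filter ℕ), ℓ ≤ i :=
    Nat.hyperfilter_le_atTop (Filter.eventually_ge_atTop ℓ)
  obtain ⟨i, hi, hℓi⟩ := ((internal_eq_iff.1 hX).and hlarge).exists
  exact hcplx i (hi ▸ (hXℓ i).mono hℓi)

theorem stmt18 (k M : ℕ) (ε : ℝ) (hε0 : 0 ≤ ε) (hε : ε < 1 / 2) :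
    ∃ ℓ : ℕ, ∀ (n : ℕ) (A : Set (Fin n → ZMod 2)),
      approxSpecNorm (ind A) ε ≤ M →
      KAffineConnected k A → KAffineConnected k Aᶜ →
      CosetCplxLe A ℓ ∧ specNorm (ind A) ≤ 3 ^ ℓ := by
  obtain ⟨ℓ, hℓ⟩ := exists_cosetCplx_bound k (K := M + 1) hε
  refine ⟨ℓ, fun n A hM hA hA' => ?_⟩
  have h := hℓ n A (exists_approximant hε0 hM) hA hA'
  exact ⟨h, h.specNorm_le⟩
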